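/- arXiv:2510.16423 — 3 statements merged into one kernel-verified Lean document; each statement's English description precedes it below -/
import Mathlib

section
/- Let p be a prime, n a positive integer, and G a finite group such that p^n does not divide |G : C_G(g)| for every p-regular element g of G. If N is a normal subgroup of G, then p^n does not divide the index of the centralizer |G/N : C_{G/N}(x̄)| for every p-regular element x̄ of the quotient group G/N. -/
/-- A `p`-regular element of a quotient lifts to a `p`-regular element. -/
theorem exists_lift_not_dvd_orderOf {G H : Type*} [Group G] [Finite G] [Group H] {p : ℕ}
    (hp : p.Prime) {f : G →* H} (hf : Function.Surjective f) {x : H} (hx : ¬ p ∣ orderOf x) :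
    ∃ g : G, f g = x ∧ ¬ p ∣ orderOf g := by
  obtain ⟨g, rfl⟩ := hf x
  have hcop : (p ^ (orderOf g).factorization p).Coprime (orderOf (f g)) :=
    ((Nat.Prime.coprime_iff_not_dvd hp).2 hx).pow_left _
  obtain ⟨k, hk0, hk1⟩ := Nat.chineseRemainder hcop 0 1
  refine ⟨g ^ k, ?_, fun hdvd => ?_⟩
  · rw [map_pow, pow_eq_pow_iff_modEq.2 hk1, pow_one]
  · obtain ⟨c, rfl⟩ := (Nat.modEq_zero_iff_dvd).1 hk0
    refine Nat.not_dvd_ordCompl hp (orderOf_pos g).ne' (hdvd.trans (orderOf_dvd_of_pow_eq_one ?_))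
    rw [← pow_mul, mul_right_comm, Nat.ordProj_mul_ordCompl_eq_self, pow_mul, pow_orderOf_eq_one,
      one_pow]

/-- Under a surjective homomorphism, the index of the centralizer of an image divides the index
of the centralizer of the element. -/
theorem index_centralizer_map_dvd {G H : Type*} [Group G] [Group H] {f : G →* H}
    (hf : Function.Surjective f) (g : G) :
    (Subgroup.centralizer {f g}).index ∣ (Subgroup.centralizer {g}).index := by
  refine (Subgroup.index_dvd_of_le ?_).trans (Subgroup.index_map_dvd _ hf)
  rintro _ ⟨c, hc, rfl⟩
  rw [SetLike.mem_coe, Subgroup.mem_centralizer_singleton_iff] at hc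
  rw [Subgroup.mem_centralizer_singleton_iff, ← map_mul, ← map_mul, hc]

/-- Suppose `p^n` does not divide `|G : C_G(g)|` for every `p`-regular element `g` of the
finite group `G`. If `N` is a normal subgroup of `G`, then `p^n` does not divide the index
of the centralizer of every `p`-regular element of the quotient group `G/N`. -/
theorem stmt_4 (p : ℕ) (hp : p.Prime) (n : ℕ) (hn : 0 < n) (G : Type*) [Group G] [Fintype G]
    (h : ∀ g : G, ¬ p ∣ orderOf g → ¬ p ^ n ∣ (Subgroup.centralizer {g}).index)
    (N : Subgroup G) [N.Normal] :
    ∀ x : G ⧸ N, ¬ p ∣ orderOf x → ¬ p ^ n ∣ (Subgroup.centralizer {x}).index := by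
  intro x hx hdvd
  have hsurj := QuotientGroup.mk'_surjective N
  obtain ⟨g, rfl, hg⟩ := exists_lift_not_dvd_orderOf hp hsurj hx
  exact h g hg (hdvd.trans (index_centralizer_map_dvd hsurj g))
end

section
/- For every prime p there exists a finite group G such that O_p(G) = 1, the largest power of p dividing |G| equals p^2, and p^2 does not divide |G : C_G(g)| for every p-regular element g of G. (Hence the bound p^2 in the main theorem is sharp.) -/
/-- The group of semilinear affine maps `x ↦ lin * gal x + trans` of a field extension `F / F₀`
whose linear coefficient has norm one. -/
@[ext]
structure NormOneAffine (F₀ F : Type) [Field F₀] [Field F] [Algebra F₀ F] where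
  trans : F
  lin : F
  norm_lin : Algebra.norm F₀ lin = 1
  gal : F ≃ₐ[F₀] F

namespace NormOneAffine

variable {F₀ F : Type} [Field F₀] [Field F] [Algebra F₀ F]

instance : Mul (NormOneAffine F₀ F) where
  mul x y := ⟨x.trans + x.lin * x.gal y.trans, x.lin * x.gal y.lin,
    by rw [map_mul, Algebra.norm_eq_of_algEquiv, x.norm_lin, y.norm_lin, one_mul], x.gal * y.gal⟩

instance : One (NormOneAffine F₀ F) where
  one := ⟨0, 1, map_one _, 1⟩

instance [FiniteDimensional F₀ F] : Inv (NormOneAffine F₀ F) where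
  inv x := ⟨-x.gal⁻¹ (x.lin⁻¹ * x.trans), x.gal⁻¹ x.lin⁻¹,
    by rw [Algebra.norm_eq_of_algEquiv, Algebra.norm_inv, x.norm_lin, inv_one], x.gal⁻¹⟩

@[simp] lemma mul_trans (x y : NormOneAffine F₀ F) :
    (x * y).trans = x.trans + x.lin * x.gal y.trans := rfl
@[simp] lemma mul_lin (x y : NormOneAffine F₀ F) : (x * y).lin = x.lin * x.gal y.lin := rfl
@[simp] lemma mul_gal (x y : NormOneAffine F₀ F) : (x * y).gal = x.gal * y.gal := rfl
@[simp] lemma one_trans : (1 : NormOneAffine F₀ F).trans = 0 := rfl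
@[simp] lemma one_lin : (1 : NormOneAffine F₀ F).lin = 1 := rfl
@[simp] lemma one_gal : (1 : NormOneAffine F₀ F).gal = 1 := rfl

variable [FiniteDimensional F₀ F]

@[simp] lemma inv_trans (x : NormOneAffine F₀ F) :
    x⁻¹.trans = -x.gal⁻¹ (x.lin⁻¹ * x.trans) := rfl
@[simp] lemma inv_lin (x : NormOneAffine F₀ F) : x⁻¹.lin = x.gal⁻¹ x.lin⁻¹ := rfl
@[simp] lemma inv_gal (x : NormOneAffine F₀ F) : x⁻¹.gal = x.gal⁻¹ := rfl

lemma lin_ne_zero (x : NormOneAffine F₀ F) : x.lin ≠ 0 := by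
  intro h
  have := x.norm_lin
  rw [h, Algebra.norm_zero] at this
  exact zero_ne_one this

instance : Group (NormOneAffine F₀ F) :=
  Group.ofLeftAxioms
    (fun x y z ↦ by ext <;> simp [mul_assoc, mul_add, add_assoc])
    (fun x ↦ by ext <;> simp)
    (fun x ↦ by
      have h := x.lin_ne_zero
      ext
      · simp [map_mul]
      · simp [h]
      · simp)

/-- The translation `x ↦ x + b`. -/
def translation (b : F) : NormOneAffine F₀ F := ⟨b, 1, map_one _, 1⟩

lemma translation_pow (b : F) (n : ℕ) :
    (translation b : NormOneAffine F₀ F) ^ n = translation (n * b) := by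
  induction n with
  | zero => ext <;> simp [translation]
  | succ n ih => rw [pow_succ, ih]; ext <;> simp [translation, add_mul]

variable (F₀ F) in
/-- The homomorphism sending a semilinear affine map to its field automorphism. -/
def galHom : NormOneAffine F₀ F →* (F ≃ₐ[F₀] F) where
  toFun := gal
  map_one' := rfl
  map_mul' _ _ := rfl

variable (F₀ F) in
/-- A semilinear affine map is given by its translation part, coefficient and automorphism. -/
def equivProd : NormOneAffine F₀ F ≃
    F × (Units.map (Algebra.norm F₀ : F →* F₀)).ker × (F ≃ₐ[F₀] F) where
  toFun x := (x.trans, ⟨Units.mk0 x.lin x.lin_ne_zero, by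
    rw [MonoidHom.mem_ker]; ext; exact x.norm_lin⟩, x.gal)
  invFun y := ⟨y.1, y.2.1.1, congrArg Units.val y.2.1.2, y.2.2⟩
  left_inv _ := rfl
  right_inv y := by ext <;> rfl

lemma eq_bot_of_normal_of_isPGroup {p r : ℕ} [CharP F r] (hpr : p.Coprime r)
    {Q : Subgroup (NormOneAffine F₀ F)} (hQ : Q.Normal) (hp : IsPGroup p Q) : Q = ⊥ := by
  have key (b : F) (hb : translation b ∈ Q) : b = 0 := by
    obtain ⟨n, hn⟩ := hp ⟨_, hb⟩
    have h1 : (translation b : NormOneAffine F₀ F) ^ p ^ n = 1 := congrArg Subtype.val hn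
    have h2 : (translation b : NormOneAffine F₀ F) ^ r = 1 := by
      rw [translation_pow, CharP.cast_eq_zero, zero_mul]; rfl
    have h3 : (translation b : NormOneAffine F₀ F) = 1 :=
      orderOf_eq_one_iff.mp (Nat.eq_one_of_dvd_coprimes (hpr.pow_left n)
        (orderOf_dvd_of_pow_eq_one h1) (orderOf_dvd_of_pow_eq_one h2))
    exact congrArg trans h3
  rw [Subgroup.eq_bot_iff_forall]
  intro x hx
  have hfix (b : F) : x.lin * x.gal b = b := by
    have hmem := Q.mul_mem hx (hQ.conj_mem _ (Q.inv_mem hx) (translation b))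
    have heq : x * (translation b * x⁻¹ * (translation b)⁻¹)
        = translation (x.lin * x.gal b - b) := by
      have h := x.lin_ne_zero
      ext <;> simp [translation, mul_add, h]
      ring
    rw [heq] at hmem
    exact sub_eq_zero.mp (key _ hmem)
  have hlin : x.lin = 1 := by simpa using hfix 1
  have hgal : x.gal = 1 := by
    ext b
    simpa [hlin] using hfix b
  have htrans : x = translation x.trans := by ext <;> simp [translation, hlin, hgal]
  have := key x.trans (htrans ▸ hx)
  rw [htrans, this]
  rfl

/-- The homothety of ratio `z` centred at `c`. -/
def homothety (c z : F) (hz : Algebra.norm F₀ z = 1) : NormOneAffine F₀ F :=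
  ⟨c - z * c, z, hz, 1⟩

lemma homothety_pow (c z : F) (hz : Algebra.norm F₀ z = 1) (n : ℕ) :
    homothety c z hz ^ n = homothety c (z ^ n) (by rw [map_pow, hz, one_pow]) := by
  induction n with
  | zero => ext <;> simp [homothety]
  | succ n ih =>
    rw [pow_succ, ih]
    ext <;> simp [homothety, pow_succ]
    ring

/-- The semilinear map with automorphism `s` fixing the nonzero element `b`. -/
def fixing (b : F) (hb : b ≠ 0) (s : F ≃ₐ[F₀] F) : NormOneAffine F₀ F :=
  ⟨0, b / s b, by
    rw [div_eq_mul_inv, map_mul, Algebra.norm_inv, Algebra.norm_eq_of_algEquiv,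
      mul_inv_cancel₀ (Algebra.norm_ne_zero_iff.mpr hb)], s⟩

lemma fixing_mul (b : F) (hb : b ≠ 0) (s t : F ≃ₐ[F₀] F) :
    fixing b hb s * fixing b hb t = fixing b hb (s * t) := by
  have : s b ≠ 0 := by simpa
  have : s (t b) ≠ 0 := by simpa
  ext <;> simp [fixing]
  field_simp

lemma fixing_pow (b : F) (hb : b ≠ 0) (s : F ≃ₐ[F₀] F) (n : ℕ) :
    fixing b hb s ^ n = fixing b hb (s ^ n) := by
  induction n with
  | zero => ext <;> simp [fixing, hb]
  | succ n ih => rw [pow_succ, ih, fixing_mul, pow_succ]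

/-- If `z` has norm one and order `p`, and `s` is an automorphism of order `p`, then every
element with trivial automorphism commutes with an element of order `p`. -/
lemma exists_orderOf_eq_commute {p : ℕ} [Fact p.Prime] {z : F} (hz : Algebra.norm F₀ z = 1)
    (hzp : z ^ p = 1) (hz1 : z ≠ 1) {s : F ≃ₐ[F₀] F} (hs : orderOf s = p)
    (g : NormOneAffine F₀ F) (hg : g.gal = 1) :
    ∃ c : NormOneAffine F₀ F, orderOf c = p ∧ g * c = c * g := by
  have hhom (c : F) : orderOf (homothety c z hz) = p := by
    refine orderOf_eq_prime ?_ fun h ↦ hz1 (congrArg lin h)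
    rw [homothety_pow]
    ext <;> simp [homothety, hzp]
  by_cases hlin : g.lin = 1
  · by_cases hb : g.trans = 0
    · refine ⟨homothety 0 z hz, hhom 0, ?_⟩
      have : g = 1 := by ext <;> simp [*]
      simp [this]
    · refine ⟨fixing g.trans hb s, orderOf_eq_prime ?_ fun h ↦ ?_, ?_⟩
      · rw [fixing_pow, ← hs, pow_orderOf_eq_one]
        ext <;> simp [fixing, hb]
      · have h1 : s = 1 := congrArg gal h
        rw [h1, orderOf_one] at hs
        exact (Fact.out : p.Prime).one_lt.ne hs
      · have : s g.trans ≠ 0 := by simpa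
        ext <;> simp [fixing, hlin, hg]
        field_simp
  · have h1 : 1 - g.lin ≠ 0 := sub_ne_zero.mpr (Ne.symm hlin)
    refine ⟨homothety (g.trans / (1 - g.lin)) z hz, hhom _, ?_⟩
    ext <;> simp [homothety, hg, mul_comm]
    field_simp
    ring

end NormOneAffine

/-- The order of a norm-one group of finite fields is the geometric sum of the base order. -/
lemma FiniteField.card_ker_unitsMap_norm (F₀ F : Type) [Field F₀] [Field F] [Algebra F₀ F]
    [Finite F] :
    Nat.card (Units.map (Algebra.norm F₀ : F →* F₀)).ker =
      ∑ i ∈ Finset.range (Module.finrank F₀ F), Nat.card F₀ ^ i := by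
  have : Finite F₀ := Finite.of_injective _ (algebraMap F₀ F).injective
  have hcard : 2 ≤ Nat.card F₀ := Finite.one_lt_card
  have h := (Units.map (Algebra.norm F₀ : F →* F₀)).ker.card_mul_index
  rw [Subgroup.index_ker, MonoidHom.range_eq_top.mpr (FiniteField.unitsMap_norm_surjective F₀ F),
    Subgroup.card_top, Nat.card_units, Nat.card_units, Module.natCard_eq_pow_finrank (K := F₀) (V := F)] at h
  rw [Nat.geomSum_eq hcard, ← h, Nat.mul_div_cancel _ (by omega)]

lemma Nat.factorization_geomSum_eq_one {p r : ℕ} (hp : p.Prime) (hr : r ≡ 1 [MOD p ^ 2]) :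
    (∑ i ∈ Finset.range p, r ^ i).factorization p = 1 := by
  have hmod : ∑ i ∈ Finset.range p, r ^ i ≡ p [MOD p ^ 2] := by
    have : (∑ i ∈ Finset.range p, (r : ZMod (p ^ 2)) ^ i) = p := by
      have h := (ZMod.natCast_eq_natCast_iff _ _ _).mpr hr
      push_cast at h
      simp [h]
    exact (ZMod.natCast_eq_natCast_iff _ _ _).mp (by push_cast; simpa using this)
  have h1 : p ∣ ∑ i ∈ Finset.range p, r ^ i :=
    (hmod.dvd_iff (dvd_pow_self p two_ne_zero)).mpr dvd_rfl
  have h2 : ¬ p ^ 2 ∣ ∑ i ∈ Finset.range p, r ^ i := fun h ↦ by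
    have := Nat.le_of_dvd hp.pos ((hmod.dvd_iff dvd_rfl).mp h)
    nlinarith [hp.one_lt]
  have h0 : ∑ i ∈ Finset.range p, r ^ i ≠ 0 := fun h ↦ h2 (h ▸ dvd_zero _)
  rw [hp.pow_dvd_iff_le_factorization h0] at h2
  have := (hp.dvd_iff_one_le_factorization h0).mp h1
  omega

/-- A centralizer containing an element of order `p` has index not divisible by the full
`p`-part `p ^ 2` of the group order. -/
lemma not_sq_dvd_index_centralizer {G : Type} [Group G] [Finite G] {p : ℕ} (hp : p.Prime)
    (hG : (Nat.card G).factorization p = 2) {g c : G} (hc : orderOf c = p)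
    (hgc : g * c = c * g) : ¬ p ^ 2 ∣ (Subgroup.centralizer {g}).index := by
  intro h
  have h1 : p ∣ Nat.card (Subgroup.centralizer {g}) := by
    rw [← hc]
    exact Subgroup.orderOf_dvd_natCard _ (Subgroup.mem_centralizer_singleton_iff.mpr hgc.symm)
  have h2 : p ^ 3 ∣ Nat.card G := by
    rw [← (Subgroup.centralizer {g}).card_mul_index, pow_succ']
    exact mul_dvd_mul h1 h
  have := (hp.pow_dvd_iff_le_factorization Nat.card_pos.ne').mp h2
  omega

/-- For every prime `p` there exists a finite group `G` with trivial `p`-core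
(every normal `p`-subgroup is trivial), with `|G|_p = p²`, such that `p²` does not divide
`|G : C_G(g)|` for every `p`-regular element `g` of `G`. -/
theorem stmt_10 (p : ℕ) (hp : p.Prime) :
    ∃ (G : Type) (_ : Group G) (_ : Fintype G),
      (∀ Q : Subgroup G, Q.Normal → IsPGroup p Q → Q = ⊥) ∧
      (Nat.card G).factorization p = 2 ∧
      ∀ g : G, ¬ p ∣ orderOf g → ¬ p ^ 2 ∣ (Subgroup.centralizer {g}).index := by
  obtain ⟨r, hr, -, hr1⟩ := Nat.exists_prime_gt_modEq_one (k := p ^ 2) 0 (pow_ne_zero 2 hp.ne_zero)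
  have : Fact r.Prime := ⟨hr⟩
  have : Fact p.Prime := ⟨hp⟩
  have hrp : r ≡ 1 [MOD p] := hr1.of_dvd (dvd_pow_self p two_ne_zero)
  have hpr : ¬ p ∣ r := fun h ↦ hp.one_lt.ne'
    (Nat.dvd_one.mp ((hrp.dvd_iff dvd_rfl).mp h))
  let F := GaloisField r p
  have hfin : Module.finrank (ZMod r) F = p := GaloisField.finrank r hp.ne_zero
  have hgal : Nat.card (F ≃ₐ[ZMod r] F) = p := by rw [IsGalois.card_aut_eq_finrank, hfin]
  have : Finite (NormOneAffine (ZMod r) F) := Finite.of_equiv _ (NormOneAffine.equivProd _ _).symm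
  have hcard : (Nat.card (NormOneAffine (ZMod r) F)).factorization p = 2 := by
    have hker := FiniteField.card_ker_unitsMap_norm (ZMod r) F
    rw [hfin, Nat.card_zmod] at hker
    have hne : ∑ i ∈ Finset.range p, r ^ i ≠ 0 := by
      rw [← hker]; exact Nat.card_pos.ne'
    rw [Nat.card_congr (NormOneAffine.equivProd _ _), Nat.card_prod, Nat.card_prod, hgal, hker,
      GaloisField.card r p hp.ne_zero,
      Nat.factorization_mul (pow_ne_zero _ hr.ne_zero) (mul_ne_zero hne hp.ne_zero),
      Nat.factorization_mul hne hp.ne_zero]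
    have h0 : (r ^ p).factorization p = 0 :=
      Nat.factorization_eq_zero_of_not_dvd fun h ↦ hpr (hp.dvd_of_dvd_pow h)
    simp only [Finsupp.add_apply, h0, Nat.factorization_geomSum_eq_one hp hr1, hp.factorization_self, Nat.reduceAdd]
  obtain ⟨s, hs⟩ := exists_prime_orderOf_dvd_card' p hgal.symm.dvd
  obtain ⟨z, hz⟩ := exists_prime_orderOf_dvd_card' (G := (ZMod r)ˣ) p (by
    rw [Nat.card_units, Nat.card_zmod]
    exact (Nat.modEq_iff_dvd' hr.one_le).mp hrp.symm)
  have hzp : (z : ZMod r) ^ p = 1 := by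
    rw [← Units.val_pow_eq_pow_val, ← hz, pow_orderOf_eq_one, Units.val_one]
  refine ⟨NormOneAffine (ZMod r) F, inferInstance, Fintype.ofFinite _, fun Q hQ hQp ↦
    NormOneAffine.eq_bot_of_normal_of_isPGroup ((Nat.coprime_primes hp hr).mpr fun h ↦ hpr h.dvd)
      hQ hQp, hcard, fun g hg ↦ ?_⟩
  have hg1 : g.gal = 1 := by
    have h1 : orderOf g.gal ∣ orderOf g := orderOf_map_dvd (NormOneAffine.galHom (ZMod r) F) g
    have h2 : orderOf g.gal ∣ p := (orderOf_dvd_natCard g.gal).trans hgal.dvd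
    rcases (Nat.dvd_prime hp).mp h2 with h | h
    · exact orderOf_eq_one_iff.mp h
    · rw [h] at h1
      exact absurd h1 hg
  obtain ⟨c, hc, hgc⟩ := NormOneAffine.exists_orderOf_eq_commute
    (z := algebraMap (ZMod r) F z) (by rw [Algebra.norm_algebraMap, hfin, hzp])
    (by rw [← map_pow, hzp, map_one])
    (fun h ↦ by
      have h1 : z = 1 := by
        ext
        exact (algebraMap (ZMod r) F).injective (by rw [h, Units.val_one, map_one])
      rw [h1, orderOf_one] at hz
      exact hp.one_lt.ne hz)
    hs g hg1
  exact not_sq_dvd_index_centralizer hp hcard hc hgc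
end

section
/- For every odd prime p there exists a finite nonsolvable group G such that O_p(G) = 1, the largest power of p dividing |G| equals p^2, and p^2 does not divide |G : C_G(g)| for every p-regular element g of G. -/
open scoped commutatorElement

theorem not_isSolvable_of_eq_commutator {G : Type*} [Group G] {x g h : G} (hx : x ≠ 1)
    (hc : x = ⁅g * x * g⁻¹, h * x * h⁻¹⁆) : ¬ Group.IsSolvable G := by
  refine not_isSolvable_of_mem_derivedSeries hx fun n => ?_
  induction n with
  | zero => exact Subgroup.mem_top x
  | succ n ih =>
    rw [hc]
    exact Subgroup.commutator_mem_commutator ((derivedSeries_normal G n).conj_mem x ih g)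
      ((derivedSeries_normal G n).conj_mem x ih h)

theorem not_isSolvable_GL_three_two : ¬ Group.IsSolvable (GL (Fin 3) (ZMod 2)) := by
  refine not_isSolvable_of_eq_commutator
    (x := ⟨!![1, 0, 1; 0, 1, 0; 0, 0, 1], !![1, 0, 1; 0, 1, 0; 0, 0, 1], by decide, by decide⟩)
    (g := ⟨!![1, 0, 0; 0, 1, 0; 0, 1, 1], !![1, 0, 0; 0, 1, 0; 0, 1, 1], by decide, by decide⟩)
    (h := ⟨!![0, 1, 1; 1, 0, 0; 0, 0, 1], !![0, 1, 0; 1, 0, 1; 0, 0, 1], by decide, by decide⟩)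
    (by decide) ?_
  refine Units.ext ?_
  simp only [commutatorElement_def, mul_inv_rev, Units.val_mul, Units.inv_mk]
  decide +kernel

theorem card_GL_three_two : Nat.card (GL (Fin 3) (ZMod 2)) = 168 := by
  rw [Matrix.card_GL_field]
  simp [Fin.prod_univ_three]

theorem exists_not_isSolvable_not_dvd_card {p : ℕ} (hp : p.Prime) (h5 : 5 ≤ p) :
    ∃ (T : Type) (_ : Group T) (_ : Finite T), ¬ Group.IsSolvable T ∧ ¬ p ∣ Nat.card T := by
  rcases h5.eq_or_lt with rfl | h
  · exact ⟨_, inferInstance, inferInstance, not_isSolvable_GL_three_two, by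
      rw [card_GL_three_two]; norm_num⟩
  · refine ⟨_, inferInstance, inferInstance, Equiv.Perm.not_isSolvable_fin_5, ?_⟩
    rw [Nat.card_perm, Nat.card_fin, hp.dvd_factorial]
    omega

/-- The conditions of the theorem on `G`, apart from nonsolvability. -/
structure IsDefectExample (p : ℕ) (G : Type*) [Group G] : Prop where
  core_eq_bot : ∀ Q : Subgroup G, Q.Normal → IsPGroup p Q → Q = ⊥
  factorization_card : (Nat.card G).factorization p = 2
  exists_mem_centralizer : ∀ g : G, ¬ p ∣ orderOf g → ∃ y, Commute y g ∧ p ∣ orderOf y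

theorem IsDefectExample.not_dvd_index {p : ℕ} (hp : p.Prime) {G : Type*} [Group G] [Finite G]
    (hG : IsDefectExample p G) {g : G} (hg : ¬ p ∣ orderOf g) :
    ¬ p ^ 2 ∣ (Subgroup.centralizer {g}).index := by
  intro h
  obtain ⟨y, hy, hpy⟩ := hG.exists_mem_centralizer g hg
  have h1 : p ∣ Nat.card (Subgroup.centralizer {g}) := hpy.trans
    (Subgroup.orderOf_dvd_natCard _ (Subgroup.mem_centralizer_singleton_iff.2 hy.eq))
  have h2 : p ^ 3 ∣ Nat.card G := by
    rw [← Subgroup.card_mul_index (Subgroup.centralizer {g}), pow_succ']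
    exact mul_dvd_mul h1 h
  have := (hp.pow_dvd_iff_le_factorization Nat.card_pos.ne').1 h2
  rw [hG.factorization_card] at this
  omega

theorem IsDefectExample.prod {p : ℕ} (hp : p.Prime) {G T : Type*} [Group G] [Finite G]
    [Group T] [Finite T] (hG : IsDefectExample p G) (hT : ¬ p ∣ Nat.card T) :
    IsDefectExample p (G × T) where
  core_eq_bot Q hQ hQp := by
    have h1 : Q.map (MonoidHom.fst G T) = ⊥ := hG.core_eq_bot _
      (hQ.map _ Prod.fst_surjective) (hQp.map _)
    rw [eq_bot_iff]
    rintro ⟨a, t⟩ hq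
    have ha : a = 1 := by
      have : a ∈ Q.map (MonoidHom.fst G T) := ⟨(a, t), hq, rfl⟩
      rwa [h1] at this
    have ht : t = 1 := by
      obtain ⟨k, hk⟩ := hQp ⟨_, hq⟩
      have hk' : t ^ p ^ k = 1 := congrArg Prod.snd (congrArg Subtype.val hk)
      have hc : (Nat.card T).Coprime (p ^ k) := ((hp.coprime_iff_not_dvd.2 hT).pow_left k).symm
      exact hc.pow_left_bijective.1 (by simpa using hk')
    simp [ha, ht]
  factorization_card := by
    rw [Nat.card_prod, Nat.factorization_mul Nat.card_pos.ne' Nat.card_pos.ne']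
    simp [hG.factorization_card, Nat.factorization_eq_zero_of_not_dvd hT]
  exists_mem_centralizer := by
    rintro ⟨g, t⟩ hg
    rw [Prod.orderOf_mk] at hg
    obtain ⟨y, hy, hpy⟩ := hG.exists_mem_centralizer g fun h => hg (h.trans (Nat.dvd_lcm_left _ _))
    refine ⟨(y, 1), hy.prod (Commute.one_left t), ?_⟩
    rwa [Prod.orderOf_mk, orderOf_one, Nat.lcm_one_right]

/-- Semidirect products of a group of order prime to `p` by a faithful group of automorphisms. -/
theorem isDefectExample_semidirectProduct {p : ℕ} (hp : p.Prime) {N A : Type*} [CommGroup N]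
    [Finite N] [Group A] [Finite A] (φ : A →* MulAut N) (hφ : Function.Injective φ)
    (hN : ¬ p ∣ Nat.card N) (hA : (Nat.card A).factorization p = 2)
    (hfix : ∀ n : N, ∃ y : A, p ∣ orderOf y ∧ φ y n = n)
    (hfree : ∀ a : A, a ≠ 1 → ¬ p ∣ orderOf a →
      (∀ n, φ a n = n → n = 1) ∧ ∃ z, p ∣ orderOf z ∧ Commute z a) :
    IsDefectExample p (N ⋊[φ] A) where
  core_eq_bot Q hQ hQp := by
    have hinl : ∀ n : N, SemidirectProduct.inl n ∈ Q → n = 1 := by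
      intro n hn
      obtain ⟨k, hk⟩ := hQp ⟨_, hn⟩
      have hk' : (SemidirectProduct.inl (n ^ p ^ k) : N ⋊[φ] A) = SemidirectProduct.inl 1 := by
        simpa using congrArg Subtype.val hk
      have hc : (Nat.card N).Coprime (p ^ k) := ((hp.coprime_iff_not_dvd.2 hN).pow_left k).symm
      exact hc.pow_left_bijective.1 (by simpa using SemidirectProduct.inl_injective hk')
    rw [eq_bot_iff]
    intro q hq
    have hright : q.right = 1 := by
      apply hφ
      ext n
      have h1 : SemidirectProduct.inl n * q * (SemidirectProduct.inl n)⁻¹ * q⁻¹ ∈ Q :=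
        Q.mul_mem (hQ.conj_mem q hq _) (Q.inv_mem hq)
      have h2 : SemidirectProduct.inl n * q * (SemidirectProduct.inl n)⁻¹ * q⁻¹ =
          SemidirectProduct.inl (φ := φ) (n * (φ q.right n)⁻¹) := by
        ext <;> simp
        rw [mul_right_comm, mul_inv_cancel_right]
      rw [h2] at h1
      simpa using (mul_inv_eq_one.1 (hinl _ h1)).symm
    have hq' : q = SemidirectProduct.inl q.left := by ext <;> simp [hright]
    rw [hq'] at hq ⊢
    simp [hinl _ hq]
  factorization_card := by
    rw [SemidirectProduct.card, Nat.factorization_mul Nat.card_pos.ne' Nat.card_pos.ne']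
    simp [hA, Nat.factorization_eq_zero_of_not_dvd hN]
  exists_mem_centralizer g hg := by
    have horder : ∀ y : A, orderOf (SemidirectProduct.inr y : N ⋊[φ] A) = orderOf y :=
      orderOf_injective _ SemidirectProduct.inr_injective
    by_cases ha : g.right = 1
    · obtain ⟨y, hpy, hy⟩ := hfix g.left
      refine ⟨SemidirectProduct.inr y, ?_, by rwa [horder]⟩
      ext <;> simp [ha, hy]
    · have hga : ¬ p ∣ orderOf g.right := fun h =>
        hg (h.trans (orderOf_map_dvd SemidirectProduct.rightHom g))
      obtain ⟨hinj, z, hpz, hz⟩ := hfree g.right ha hga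
      obtain ⟨t, ht⟩ : ∃ t : N, t * (φ g.right t)⁻¹ = g.left := by
        refine Finite.surjective_of_injective
          (f := (MonoidHom.id N / (φ g.right).toMonoidHom : N →* N)) ?_ g.left |>.imp
          fun t ht => by simpa [div_eq_mul_inv] using ht
        rw [injective_iff_map_eq_one]
        intro n hn
        exact hinj n (div_eq_one.1 (by simpa using hn)).symm
      have hconj : g = SemidirectProduct.inl t * SemidirectProduct.inr g.right *
          (SemidirectProduct.inl t)⁻¹ := by
        ext <;> simp [ht]
      refine ⟨SemidirectProduct.inl t * SemidirectProduct.inr z * (SemidirectProduct.inl t)⁻¹,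
        ?_, ?_⟩
      · rw [hconj]
        exact (hz.map SemidirectProduct.inr).conj _
      · rwa [← MulAut.conj_apply, MulEquiv.orderOf_eq, horder]

theorem exists_isDefectExample_of_addMonoidEnd {p : ℕ} (hp : p.Prime) {W A : Type}
    [AddCommGroup W] [Finite W] [Group A] [Finite A] (ρ : A →* AddMonoid.End W)
    (hρ : Function.Injective ρ) (hW : ¬ p ∣ Nat.card W) (hA : (Nat.card A).factorization p = 2)
    (hfix : ∀ w : W, ∃ y : A, p ∣ orderOf y ∧ ρ y w = w)
    (hfree : ∀ a : A, a ≠ 1 → ¬ p ∣ orderOf a →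
      (∀ w, ρ a w = w → w = 0) ∧ ∃ z, p ∣ orderOf z ∧ Commute z a) :
    ∃ (G : Type) (_ : Group G) (_ : Finite G) (f : G →* A),
      Function.Surjective f ∧ IsDefectExample p G := by
  let φ : A →* MulAut (Multiplicative W) := MonoidHom.mk'
    (fun a =>
      { toFun := fun w => .ofAdd (ρ a w.toAdd)
        invFun := fun w => .ofAdd (ρ a⁻¹ w.toAdd)
        left_inv := fun w => by
          change Multiplicative.ofAdd ((ρ a⁻¹ * ρ a) w.toAdd) = w
          simp [← map_mul]
        right_inv := fun w => by
          change Multiplicative.ofAdd ((ρ a * ρ a⁻¹) w.toAdd) = w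
          simp [← map_mul]
        map_mul' := fun v w => congrArg Multiplicative.ofAdd (map_add (ρ a) v.toAdd w.toAdd) })
    (fun a b => by ext w; simp)
  refine ⟨Multiplicative W ⋊[φ] A, inferInstance,
    Finite.of_equiv _ SemidirectProduct.equivProd.symm, SemidirectProduct.rightHom,
    SemidirectProduct.rightHom_surjective, isDefectExample_semidirectProduct hp φ
      (fun a b h => hρ ?_) (by rwa [Nat.card_congr Multiplicative.toAdd]) hA hfix hfree⟩
  ext w
  exact congrArg Multiplicative.toAdd (DFunLike.congr_fun h (Multiplicative.ofAdd w))

/-- This is where oddness of `p` enters. -/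
theorem factorization_pow_sub_one_div {p q : ℕ} (hp : p.Prime) (hodd : Odd p) (hq : 1 < q)
    (hpq : p ∣ q - 1) : ((q ^ p - 1) / (q - 1)).factorization p = 1 := by
  have hpq' : ¬ p ∣ q := fun h => hp.one_lt.ne' (Nat.dvd_one.1 (by
    simpa [Nat.sub_sub_self hq.le] using Nat.dvd_sub h hpq))
  have : Fact p.Prime := ⟨hp⟩
  have h := padicValNat.pow_sub_pow hodd hq hpq hpq' hp.ne_zero
  have hd : q - 1 ∣ q ^ p - 1 := by simpa using Nat.sub_dvd_pow_sub_pow q 1 p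
  rw [one_pow, padicValNat_self] at h
  rw [Nat.factorization_div hd]
  simp only [Finsupp.coe_tsub, Pi.sub_apply, Nat.factorization_def _ hp, h]
  omega

noncomputable section Semilinear

variable (q p : ℕ) [Fact q.Prime]

/-- The elements of norm one in the field with `q ^ p` elements. -/
abbrev NormOne : Type := rootsOfUnity ((q ^ p - 1) / (q - 1)) (GaloisField q p)

/-- The natural action of the Galois group on the elements of norm one. -/
def galoisAction : Gal(GaloisField q p/ZMod q) →* MulAut (NormOne q p) where
  toFun σ := σ.toRingEquiv.toMulEquiv.restrictRootsOfUnity _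
  map_one' := by ext; rfl
  map_mul' _ _ := by ext; rfl

/-- The semilinear maps whose linear part is multiplication by an element of norm one. -/
abbrev NormOneSemilinear : Type := NormOne q p ⋊[galoisAction q p] Gal(GaloisField q p/ZMod q)

/-- The natural action of the semilinear maps on the field. -/
def semilinearAction : NormOneSemilinear q p →* AddMonoid.End (GaloisField q p) where
  toFun a := (AddMonoidHom.mulLeft (a.left.1 : GaloisField q p)).comp
    (a.right.toRingEquiv.toAddEquiv.toAddMonoidHom : GaloisField q p →+ GaloisField q p)
  map_one' := by
    ext x
    change ((1 : (GaloisField q p)ˣ) : GaloisField q p) * x = x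
    simp
  map_mul' a b := by
    ext x
    change ((a.left.1 : GaloisField q p) * a.right (b.left.1 : GaloisField q p)) *
      a.right (b.right x) = a.left.1 * a.right (b.left.1 * b.right x)
    rw [map_mul, mul_assoc]

instance : Finite (NormOneSemilinear q p) := Finite.of_equiv _ SemidirectProduct.equivProd.symm

theorem semilinearAction_apply (a : NormOneSemilinear q p) (x : GaloisField q p) :
    semilinearAction q p a x = (a.left.1 : GaloisField q p) * a.right x := rfl

theorem semilinearAction_injective : Function.Injective (semilinearAction q p) := by
  intro a b h
  have h' : ∀ x, (a.left.1 : GaloisField q p) * a.right x = b.left.1 * b.right x :=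
    fun x => DFunLike.congr_fun h x
  have h1 : (a.left.1 : GaloisField q p) = b.left.1 := by simpa using h' 1
  refine SemidirectProduct.ext (Subtype.ext (Units.ext h1)) (AlgEquiv.ext fun x => ?_)
  have := h' x
  rw [h1] at this
  exact mul_left_cancel₀ (Units.ne_zero _) this

theorem exists_isDefectExample_of_dvd_sub_one {q p : ℕ} [Fact q.Prime] [hp : Fact p.Prime]
    (hodd : Odd p) (hpq : p ∣ q - 1) :
    ∃ (G : Type) (_ : Group G) (_ : Finite G), IsDefectExample p G := by
  have hq1 : 1 < q := Fact.out (p := q.Prime) |>.one_lt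
  have hd : q - 1 ∣ q ^ p - 1 := by simpa using Nat.sub_dvd_pow_sub_pow q 1 p
  have hdp : p ∣ (q ^ p - 1) / (q - 1) := Nat.dvd_of_factorization_pos (by
    rw [factorization_pow_sub_one_div hp.out hodd hq1 hpq]; norm_num)
  have hm0 : (q ^ p - 1) / (q - 1) ≠ 0 := by
    intro h
    have := factorization_pow_sub_one_div hp.out hodd hq1 hpq
    simp [h] at this
  have : Fintype (GaloisField q p) := Fintype.ofFinite _
  have hcard : Nat.card (GaloisField q p) = q ^ p := GaloisField.card q p hp.out.ne_zero
  have hunits : Nat.card (GaloisField q p)ˣ = q ^ p - 1 := by rw [Nat.card_units, hcard]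
  have hgal : Nat.card Gal(GaloisField q p/ZMod q) = p := by
    rw [IsGalois.card_aut_eq_finrank, GaloisField.finrank q hp.out.ne_zero]
  have hN : Nat.card (NormOne q p) = (q ^ p - 1) / (q - 1) := by
    have h := IsCyclic.card_powMonoidHom_ker (G := (GaloisField q p)ˣ) ((q ^ p - 1) / (q - 1))
    rwa [hunits, Nat.gcd_eq_right (Nat.div_dvd_of_dvd hd)] at h
  have hright : ∀ a : NormOneSemilinear q p, a.right ≠ 1 → p ∣ orderOf a := fun a ha => by
    have h1 : orderOf a.right ∣ p := (orderOf_dvd_natCard a.right).trans hgal.dvd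
    rcases (Nat.dvd_prime hp.out).1 h1 with h | h
    · exact absurd (orderOf_eq_one_iff.1 h) ha
    · exact h.symm.dvd.trans (orderOf_map_dvd SemidirectProduct.rightHom a)
  have hW : ¬ p ∣ Nat.card (GaloisField q p) := by
    rw [hcard]
    intro h
    have h := hp.out.dvd_of_dvd_pow h
    exact hp.out.one_lt.ne' (Nat.dvd_one.1 (by
      simpa [Nat.sub_sub_self hq1.le] using Nat.dvd_sub h hpq))
  have hA : (Nat.card (NormOneSemilinear q p)).factorization p = 2 := by
    rw [SemidirectProduct.card, hN, hgal, Nat.factorization_mul hm0 hp.out.ne_zero]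
    simp [factorization_pow_sub_one_div hp.out hodd hq1 hpq, hp.out.factorization_self]
  -- the Frobenius, corrected by `w / w ^ q`, fixes `w`
  have hfix : ∀ w, ∃ y : NormOneSemilinear q p, p ∣ orderOf y ∧ semilinearAction q p y w = w := by
    intro w
    let σ : Gal(GaloisField q p/ZMod q) := FiniteField.frobeniusAlgEquivOfAlgebraic _ _
    have hσ : ∀ x, σ x = x ^ q := fun x => by
      simp [σ]
    have hσ1 : σ ≠ 1 := by
      intro h
      have h2 := FiniteField.orderOf_frobeniusAlgEquivOfAlgebraic (ZMod q) (GaloisField q p)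
      have h3 : orderOf σ = p := h2.trans (GaloisField.finrank q hp.out.ne_zero)
      rw [h, orderOf_one] at h3
      exact hp.out.one_lt.ne h3
    by_cases hw : w = 0
    · exact ⟨⟨1, σ⟩, hright _ hσ1, by simp [hw]⟩
    · let u : (GaloisField q p)ˣ := Units.mk0 w hw
      have hu : (u ^ (q - 1))⁻¹ ∈ rootsOfUnity ((q ^ p - 1) / (q - 1)) (GaloisField q p) := by
        rw [mem_rootsOfUnity, inv_pow, ← pow_mul, Nat.mul_div_cancel' hd, ← hunits,
          pow_card_eq_one', inv_one]
      refine ⟨⟨⟨_, hu⟩, σ⟩, hright _ hσ1, ?_⟩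
      rw [semilinearAction_apply]
      simp only [hσ]
      have : w ^ q = w ^ (q - 1) * w := by rw [← pow_succ, Nat.sub_add_cancel hq1.le]
      rw [this]
      simp [u, hw]
  have hfree : ∀ a : NormOneSemilinear q p, a ≠ 1 → ¬ p ∣ orderOf a →
      (∀ w, semilinearAction q p a w = w → w = 0) ∧ ∃ z, p ∣ orderOf z ∧ Commute z a := by
    intro a ha1 hap
    have har : a.right = 1 := by
      by_contra h
      exact hap (hright a h)
    have ha : a = SemidirectProduct.inl a.left := by ext <;> simp [har]
    have hal : a.left ≠ 1 := fun h => ha1 (by rw [ha, h, map_one])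
    refine ⟨fun w hw => ?_, ?_⟩
    · rw [semilinearAction_apply, har, AlgEquiv.one_apply] at hw
      by_contra h0
      exact hal (Subtype.ext (Units.ext (mul_right_cancel₀ h0 (hw.trans (one_mul w).symm))))
    · obtain ⟨z, hz⟩ := exists_prime_orderOf_dvd_card' (G := NormOne q p) p (hN ▸ hdp)
      refine ⟨SemidirectProduct.inl z, ?_, ?_⟩
      · rw [orderOf_injective _ SemidirectProduct.inl_injective, hz]
      · rw [ha]
        exact (Commute.all z a.left).map SemidirectProduct.inl
  obtain ⟨G, _, _, _, _, hG⟩ := exists_isDefectExample_of_addMonoidEnd hp.out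
    (semilinearAction q p) (semilinearAction_injective q p) hW hA hfix hfree
  exact ⟨G, _, ‹_›, hG⟩

end Semilinear

/-- Two-by-two matrices over `ℕ`, read modulo `19` row by row. -/
abbrev Quad := ℕ × ℕ × ℕ × ℕ

/-- Matrix multiplication modulo `19`. -/
def Quad.mul (x y : Quad) : Quad :=
  ((x.1 * y.1 + x.2.1 * y.2.2.1) % 19, (x.1 * y.2.1 + x.2.1 * y.2.2.2) % 19,
    (x.2.2.1 * y.1 + x.2.2.2 * y.2.2.1) % 19, (x.2.2.1 * y.2.1 + x.2.2.2 * y.2.2.2) % 19)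

/-- The powers of `icosA`. -/
def icosahedralA : List Quad :=
  [(1, 0, 0, 1), (0, 7, 8, 5), (18, 16, 2, 5), (14, 16, 2, 1), (14, 7, 8, 0), (18, 0, 0, 18),
    (0, 12, 11, 14), (1, 3, 17, 14), (5, 3, 17, 18), (5, 12, 11, 0)]

/-- Representatives for the right cosets of the powers of `icosA`. -/
def icosahedralR : List Quad :=
  [(1, 0, 0, 1), (0, 18, 1, 0), (11, 14, 0, 7), (14, 8, 7, 0), (17, 14, 18, 16), (14, 2, 16, 1),
    (17, 18, 14, 16), (16, 13, 8, 3), (9, 6, 5, 14), (3, 3, 4, 17), (5, 13, 13, 15),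
    (13, 14, 15, 6)]

/-- The elements of `binaryIcosahedral`. -/
def icosahedralList : List Quad :=
  icosahedralA.flatMap fun a => icosahedralR.map a.mul

theorem icosahedralList_mul_left : ∀ x ∈ icosahedralList,
    Quad.mul (0, 7, 8, 5) x ∈ icosahedralList ∧ Quad.mul (0, 18, 1, 0) x ∈ icosahedralList := by
  decide +kernel

theorem icosahedralList_det_sub_one : ∀ x ∈ icosahedralList, x = (1, 0, 0, 1) ∨
    ¬ 19 ∣ (x.1 + 18) * (x.2.2.2 + 18) + 18 * (x.2.1 * x.2.2.1) := by
  decide +kernel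

/-- The matrix over `ZMod 19` given by a quadruple. -/
def Quad.toMatrix (x : Quad) : Matrix (Fin 2) (Fin 2) (ZMod 19) :=
  !![(x.1 : ZMod 19), (x.2.1 : ZMod 19); (x.2.2.1 : ZMod 19), (x.2.2.2 : ZMod 19)]

theorem Quad.toMatrix_mul (x y : Quad) : (x.mul y).toMatrix = x.toMatrix * y.toMatrix := by
  ext i j
  fin_cases i <;> fin_cases j <;>
    simp [Quad.toMatrix, Quad.mul, Matrix.mul_apply, Fin.sum_univ_two, -Nat.reduceMod]

/-- The ambient group of the binary icosahedral group. -/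
abbrev SL19 : Type := Matrix.SpecialLinearGroup (Fin 2) (ZMod 19)

/-- A generator of order `10`. -/
def icosA : SL19 := ⟨!![0, 7; 8, 5], by decide⟩

/-- A generator of order `4`. -/
def icosB : SL19 := ⟨!![0, 18; 1, 0], by decide⟩

/-- A copy of `SL(2, 5)`. -/
def binaryIcosahedral : Subgroup SL19 := Subgroup.closure {icosA, icosB}

theorem icosA_mem : icosA ∈ binaryIcosahedral := Subgroup.subset_closure (by simp)

theorem icosB_mem : icosB ∈ binaryIcosahedral := Subgroup.subset_closure (by simp)

theorem exists_mem_icosahedralList {h : SL19} (hh : h ∈ binaryIcosahedral) :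
    ∃ x ∈ icosahedralList, h.1 = x.toMatrix := by
  rw [binaryIcosahedral, ← Subgroup.mem_toSubmonoid,
    Subgroup.closure_toSubmonoid_of_finite] at hh
  induction hh using Submonoid.closure_induction_left with
  | one =>
    refine ⟨(1, 0, 0, 1), by decide, ?_⟩
    ext i j
    fin_cases i <;> fin_cases j <;> simp [Quad.toMatrix]
  | mul_left a ha b _ ih =>
    obtain ⟨x, hx, hb⟩ := ih
    rcases ha with rfl | rfl
    · refine ⟨_, (icosahedralList_mul_left x hx).1, ?_⟩
      rw [Quad.toMatrix_mul, ← hb]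
      rfl
    · refine ⟨_, (icosahedralList_mul_left x hx).2, ?_⟩
      rw [Quad.toMatrix_mul, ← hb]
      rfl

instance : Fact (Nat.Prime 19) := ⟨by norm_num⟩

theorem orderOf_icosA_sq : orderOf (icosA ^ 2) = 5 :=
  haveI : Fact (Nat.Prime 5) := ⟨by norm_num⟩
  orderOf_eq_prime (by decide +kernel) (by decide +kernel)

theorem orderOf_icosB : orderOf icosB = 4 :=
  orderOf_eq_prime_pow (p := 2) (n := 1) (by decide +kernel) (by decide +kernel)

theorem orderOf_icosA_mul_icosB : orderOf (icosA * icosB) = 3 :=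
  orderOf_eq_prime (by decide +kernel) (by decide +kernel)

theorem card_binaryIcosahedral_le : Nat.card binaryIcosahedral ≤ 120 := by
  classical
  let f : binaryIcosahedral → icosahedralList.toFinset := fun h =>
    ⟨(exists_mem_icosahedralList h.2).choose,
      List.mem_toFinset.2 (exists_mem_icosahedralList h.2).choose_spec.1⟩
  have hf : Function.Injective f := fun g h e => by
    refine Subtype.ext (Subtype.ext ?_)
    rw [(exists_mem_icosahedralList g.2).choose_spec.2,
      (exists_mem_icosahedralList h.2).choose_spec.2]
    exact congrArg (fun x => Quad.toMatrix x.1) e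
  calc Nat.card binaryIcosahedral ≤ Nat.card icosahedralList.toFinset :=
        Nat.card_le_card_of_injective f hf
    _ ≤ icosahedralList.length := by
      rw [Nat.card_eq_fintype_card, Fintype.card_coe]
      exact List.toFinset_card_le _
    _ = 120 := by decide

theorem eq_zero_of_mulVec_eq {h : SL19} (hh : h ∈ binaryIcosahedral) (h1 : h ≠ 1)
    {v : Fin 2 → ZMod 19} (hv : h.1.mulVec v = v) : v = 0 := by
  obtain ⟨x, hx, hm⟩ := exists_mem_icosahedralList hh
  refine Matrix.eq_zero_of_mulVec_eq_zero (M := h.1 - 1) ?_ (by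
    rw [Matrix.sub_mulVec, hv, Matrix.one_mulVec, sub_self])
  rcases icosahedralList_det_sub_one x hx with rfl | hdet
  · refine absurd (Subtype.ext ?_) h1
    rw [hm]
    ext i j
    fin_cases i <;> fin_cases j <;> simp [Quad.toMatrix]
  · rw [← ZMod.natCast_eq_zero_iff] at hdet
    intro h0
    apply hdet
    rw [hm, Matrix.det_fin_two] at h0
    simp [Quad.toMatrix] at h0
    push_cast
    have : (18 : ZMod 19) = -1 := by decide
    rw [this]
    linear_combination h0

theorem not_isSolvable_binaryIcosahedral : ¬ Group.IsSolvable binaryIcosahedral := by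
  refine not_isSolvable_of_eq_commutator (x := ⟨icosA, icosA_mem⟩) (g := ⟨icosB, icosB_mem⟩)
    (h := ⟨icosA, icosA_mem⟩ * ⟨icosB, icosB_mem⟩ * ⟨icosA, icosA_mem⟩ ^ 2 * ⟨icosB, icosB_mem⟩)
    ?_ ?_
  · rw [Ne, Subtype.ext_iff]
    decide +kernel
  · rw [Subtype.ext_iff]
    simp only [commutatorElement_def]
    decide +kernel

theorem factorization_card_binaryIcosahedral :
    (Nat.card binaryIcosahedral).factorization 3 = 1 := by
  have h3 : 3 ∣ Nat.card binaryIcosahedral := orderOf_icosA_mul_icosB ▸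
    Subgroup.orderOf_dvd_natCard _ (mul_mem icosA_mem icosB_mem)
  have h4 : 4 ∣ Nat.card binaryIcosahedral := orderOf_icosB ▸
    Subgroup.orderOf_dvd_natCard _ icosB_mem
  have h5 : 5 ∣ Nat.card binaryIcosahedral := orderOf_icosA_sq ▸
    Subgroup.orderOf_dvd_natCard _ (pow_mem icosA_mem 2)
  have hpos : 0 < Nat.card binaryIcosahedral := Nat.card_pos
  have hle := card_binaryIcosahedral_le
  refine le_antisymm ?_ ((Nat.prime_three.dvd_iff_one_le_factorization hpos.ne').1 h3)
  by_contra! h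
  have h9 : 3 ^ 2 ∣ Nat.card binaryIcosahedral :=
    (Nat.prime_three.pow_dvd_iff_le_factorization hpos.ne').2 h
  omega

/-- The product of a word in `icosA` (`true`) and `icosB` (`false`). -/
def Quad.ofWord : List Bool → Quad :=
  List.foldr (fun b => Quad.mul (if b then (0, 7, 8, 5) else (0, 18, 1, 0))) (1, 0, 0, 1)

theorem exists_eq_toMatrix_ofWord (w : List Bool) :
    ∃ h ∈ binaryIcosahedral, h.1 = (Quad.ofWord w).toMatrix := by
  induction w with
  | nil =>
    refine ⟨1, one_mem _, ?_⟩
    ext i j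
    fin_cases i <;> fin_cases j <;> simp [Quad.toMatrix, Quad.ofWord]
  | cons b w ih =>
    obtain ⟨h, hh, e⟩ := ih
    cases b
    · exact ⟨icosB * h, mul_mem icosB_mem hh, (congrArg (icosB.1 * ·) e).trans
        (Quad.toMatrix_mul (0, 18, 1, 0) _).symm⟩
    · exact ⟨icosA * h, mul_mem icosA_mem hh, (congrArg (icosA.1 * ·) e).trans
        (Quad.toMatrix_mul (0, 7, 8, 5) _).symm⟩

/-- Words for the elements of order three. -/
def orderThreeWords : List (List Bool) :=
  (List.range 5).flatMap fun i =>
    [[true, false], [true, false, true, false],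
      [true, false, true, true, true, false, false, false],
      [true, true, false, true, true, true, false, false, false]].map fun r =>
        List.replicate i true ++ r ++ List.replicate (10 - i) true

theorem exists_mem_orderThreeWords : ∀ a < 19, ∀ b < 19,
    ∃ x ∈ orderThreeWords.map Quad.ofWord,
      (x.1 * a + x.2.1 * b) % 19 = 7 * a % 19 ∧
      (x.2.2.1 * a + x.2.2.2 * b) % 19 = 7 * b % 19 := by
  decide +kernel

theorem exists_mulVec_eq_seven_smul (v : Fin 2 → ZMod 19) :
    ∃ h ∈ binaryIcosahedral, h.1.mulVec v = (7 : ZMod 19) • v := by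
  obtain ⟨x, hx, h0, h1⟩ := exists_mem_orderThreeWords _ (v 0).val_lt _ (v 1).val_lt
  obtain ⟨w, -, rfl⟩ := List.mem_map.1 hx
  obtain ⟨h, hh, e⟩ := exists_eq_toMatrix_ofWord w
  refine ⟨h, hh, ?_⟩
  rw [e]
  replace h0 := (ZMod.natCast_eq_natCast_iff _ _ 19).2 h0
  replace h1 := (ZMod.natCast_eq_natCast_iff _ _ 19).2 h1
  push_cast [ZMod.natCast_zmod_val] at h0 h1
  ext i
  fin_cases i
  · simpa [Quad.toMatrix, Matrix.mulVec, dotProduct, Fin.sum_univ_two] using h0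
  · simpa [Quad.toMatrix, Matrix.mulVec, dotProduct, Fin.sum_univ_two] using h1

theorem card_rootsOfUnity_three : Nat.card (rootsOfUnity 3 (ZMod 19)) = 3 := by
  have h : IsPrimitiveRoot (7 : ZMod 19) 3 :=
    IsPrimitiveRoot.iff_orderOf.2 (orderOf_eq_prime (by decide) (by decide))
  exact h.card_rootsOfUnity

/-- The action on the plane of the binary icosahedral group and the scalars of order three. -/
def icosahedralAction :
    binaryIcosahedral × rootsOfUnity 3 (ZMod 19) →* AddMonoid.End (Fin 2 → ZMod 19) where
  toFun a := DistribSMul.toAddMonoidHom _ (a.2 : (ZMod 19)ˣ) |>.comp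
    (Matrix.mulVecLin a.1.1.1).toAddMonoidHom
  map_one' := by
    ext1 v
    change (1 : ZMod 19) • (1 : Matrix (Fin 2) (Fin 2) (ZMod 19)).mulVec v = v
    simp
  map_mul' a b := by
    ext1 v
    change ((a.2 : (ZMod 19)ˣ) * (b.2 : (ZMod 19)ˣ) : ZMod 19) • (a.1.1.1 * b.1.1.1).mulVec v =
      ((a.2 : (ZMod 19)ˣ) : ZMod 19) • a.1.1.1.mulVec
        (((b.2 : (ZMod 19)ˣ) : ZMod 19) • b.1.1.1.mulVec v)
    rw [Matrix.mulVec_smul, Matrix.mulVec_mulVec, mul_smul]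

theorem icosahedralAction_apply (a : binaryIcosahedral × rootsOfUnity 3 (ZMod 19))
    (v : Fin 2 → ZMod 19) :
    icosahedralAction a v = ((a.2 : (ZMod 19)ˣ) : ZMod 19) • a.1.1.1.mulVec v := rfl

theorem icosahedralAction_injective : Function.Injective icosahedralAction := by
  rw [injective_iff_map_eq_one]
  rintro ⟨h, u⟩ e
  have hv (v) : ((u : (ZMod 19)ˣ) : ZMod 19) • h.1.1.mulVec v = v := DFunLike.congr_fun e v
  have hm : ((u : (ZMod 19)ˣ) : ZMod 19) • h.1.1 = 1 :=
    Matrix.mulVec_injective (funext fun v => by rw [Matrix.smul_mulVec, hv, Matrix.one_mulVec])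
  have hu2 : (u : (ZMod 19)ˣ) ^ 2 = 1 := Units.ext (by
    simpa [Matrix.det_smul] using congrArg Matrix.det hm)
  have hu3 : (u : (ZMod 19)ˣ) ^ 3 = 1 := (mem_rootsOfUnity _ _).1 u.2
  have hu : u = 1 := Subtype.ext (by rwa [pow_succ, hu2, one_mul] at hu3)
  subst hu
  refine Prod.ext (Subtype.ext (Subtype.ext ?_)) rfl
  simpa using hm

theorem exists_isDefectExample_three :
    ∃ (G : Type) (_ : Group G) (_ : Finite G), ¬ Group.IsSolvable G ∧ IsDefectExample 3 G := by
  have card3 := card_rootsOfUnity_three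
  have pow3 (u : rootsOfUnity 3 (ZMod 19)) : u ^ 3 = 1 :=
    Subtype.ext ((mem_rootsOfUnity _ _).1 u.2)
  let c : rootsOfUnity 3 (ZMod 19) :=
    ⟨Units.mk0 7 (by decide), (mem_rootsOfUnity _ _).2 (Units.ext (by decide))⟩
  have hc : orderOf c = 3 := orderOf_eq_prime (pow3 c) fun h =>
    absurd (congrArg (fun u : rootsOfUnity 3 (ZMod 19) => ((u : (ZMod 19)ˣ) : ZMod 19)) h)
      (by decide)
  have hA : (Nat.card (binaryIcosahedral × rootsOfUnity 3 (ZMod 19))).factorization 3 = 2 := by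
    rw [Nat.card_prod, Nat.factorization_mul Nat.card_pos.ne' Nat.card_pos.ne', card3,
      Finsupp.add_apply, factorization_card_binaryIcosahedral, Nat.prime_three.factorization_self]
  have hfix : ∀ w, ∃ y : binaryIcosahedral × rootsOfUnity 3 (ZMod 19),
      3 ∣ orderOf y ∧ icosahedralAction y w = w := by
    intro w
    obtain ⟨h, hh, e⟩ := exists_mulVec_eq_seven_smul w
    refine ⟨(⟨h, hh⟩, c⁻¹), ?_, ?_⟩
    · rw [Prod.orderOf_mk, orderOf_inv, hc]
      exact Nat.dvd_lcm_right _ _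
    · rw [icosahedralAction_apply]
      change (7⁻¹ : ZMod 19) • h.1.mulVec w = w
      rw [e, inv_smul_smul₀ (by decide)]
  have hfree : ∀ a : binaryIcosahedral × rootsOfUnity 3 (ZMod 19), a ≠ 1 → ¬ 3 ∣ orderOf a →
      (∀ w, icosahedralAction a w = w → w = 0) ∧ ∃ z, 3 ∣ orderOf z ∧ Commute z a := by
    rintro ⟨h, u⟩ h1 hp
    have hu : u = 1 := by
      rw [Prod.orderOf_mk] at hp
      rw [← orderOf_eq_one_iff]
      exact ((Nat.dvd_prime Nat.prime_three).1 (orderOf_dvd_of_pow_eq_one (pow3 u))).resolve_right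
        fun h3 => hp (h3.symm.dvd.trans (Nat.dvd_lcm_right _ _))
    subst hu
    refine ⟨fun w hw => eq_zero_of_mulVec_eq h.2 (fun e => h1 ?_) (by
      simpa [icosahedralAction_apply] using hw), (1, c), ?_, ?_⟩
    · exact Prod.ext (Subtype.ext e) rfl
    · simp [Prod.orderOf_mk, hc]
    · exact (Commute.one_left h).prod (Commute.one_right c)
  obtain ⟨G, _, _, f, hf, hG⟩ := exists_isDefectExample_of_addMonoidEnd Nat.prime_three
    icosahedralAction icosahedralAction_injective (by simp) hA hfix hfree
  refine ⟨G, _, inferInstance, fun h => not_isSolvable_binaryIcosahedral ?_, hG⟩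
  exact Group.isSolvable_of_surjective
    (f := (MonoidHom.fst _ (rootsOfUnity 3 (ZMod 19))).comp f) (Prod.fst_surjective.comp hf)

/-- For every odd prime `p` there exists a finite nonsolvable group `G` with trivial
`p`-core (every normal `p`-subgroup is trivial), with `|G|_p = p²`, such that `p²` does
not divide `|G : C_G(g)|` for every `p`-regular element `g` of `G`. -/
theorem stmt_11 (p : ℕ) (hp : p.Prime) (hodd : Odd p) :
    ∃ (G : Type) (_ : Group G) (_ : Fintype G),
      ¬ IsSolvable G ∧
      (∀ Q : Subgroup G, Q.Normal → IsPGroup p Q → Q = ⊥) ∧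
      (Nat.card G).factorization p = 2 ∧
      ∀ g : G, ¬ p ∣ orderOf g → ¬ p ^ 2 ∣ (Subgroup.centralizer {g}).index := by
  obtain ⟨G, _, _, hs, hG⟩ :
      ∃ (G : Type) (_ : Group G) (_ : Finite G), ¬ Group.IsSolvable G ∧ IsDefectExample p G := by
    rcases eq_or_ne p 3 with rfl | h3
    · exact exists_isDefectExample_three
    · have h5 : 5 ≤ p := by
        have := hp.two_le
        obtain ⟨k, rfl⟩ := hodd
        omega
      have : Fact p.Prime := ⟨hp⟩
      obtain ⟨q, hq, -, hqp⟩ := Nat.exists_prime_gt_modEq_one 1 hp.ne_zero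
      have : Fact q.Prime := ⟨hq⟩
      obtain ⟨G, _, _, hG⟩ := exists_isDefectExample_of_dvd_sub_one hodd
        ((Nat.modEq_iff_dvd' hq.one_le).1 hqp.symm)
      obtain ⟨T, _, _, hT, hpT⟩ := exists_not_isSolvable_not_dvd_card hp h5
      exact ⟨G × T, inferInstance, inferInstance, fun _ => hT
        (Group.isSolvable_of_surjective (f := MonoidHom.snd G T) Prod.snd_surjective),
        hG.prod hp hpT⟩
  exact ⟨G, _, Fintype.ofFinite G, hs, hG.core_eq_bot, hG.factorization_card,
    fun _ hg => hG.not_dvd_index hp hg⟩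
end
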